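/- Let n and r be positive integers with r dividing n. Then the r-regular multipermutation Ulam sphere of radius 1 centered at m_e^r has size |S(m_e^r, 1)| = 1 + (n−1)(n/r − 1). -/

import Mathlib

/-- Length of a longest common subsequence of two lists. -/
noncomputable def lcsLen {α : Type*} (x y : List α) : ℕ :=
  sSup {k | ∃ z : List α, z.length = k ∧ z.Sublist x ∧ z.Sublist y}
/-- The `r`-regular multipermutation `m_σ^r` of `σ`, with values in `{1, …, n/r}`:
`m_σ^r(i) = j` iff `(j-1)r + 1 ≤ σ(i) ≤ jr` (with `σ(i)` read as a 1-indexed value). -/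
def mreg {n : ℕ} (r : ℕ) (σ : Equiv.Perm (Fin n)) : Fin n → ℕ :=
  fun i => (σ i : ℕ) / r + 1
/-- The `r`-regular Ulam distance between length-`n` sequences:
`n` minus the length of a longest common subsequence. -/
noncomputable def mdist {n : ℕ} {α : Type*} (x y : Fin n → α) : ℕ :=
  n - lcsLen (List.ofFn x) (List.ofFn y)
/-- The `r`-regular multipermutation Ulam sphere of radius `t` centered at `m_σ^r`. -/
noncomputable def msphere {n : ℕ} (r : ℕ) (σ : Equiv.Perm (Fin n)) (t : ℕ) :
    Set (Fin n → ℕ) :=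
  {m | ∃ π : Equiv.Perm (Fin n), m = mreg r π ∧ mdist (mreg r σ) (mreg r π) ≤ t}

theorem List.Sublist.exists_eq_eraseIdx {α : Type*} {x y : List α} (h : x.Sublist y)
    (hl : y.length = x.length + 1) : ∃ i < y.length, x = y.eraseIdx i := by
  induction h with
  | slnil => simp at hl
  | @cons x y a h _ =>
    exact ⟨0, by simp, by simpa using h.eq_of_length (by simpa using hl.symm)⟩
  | @cons_cons x y a h ih =>
    obtain ⟨i, hi, rfl⟩ := ih (by simpa using hl)
    exact ⟨i + 1, by simpa using hi, by simp⟩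

theorem exists_sublist_length_eq_lcsLen {α : Type*} (x y : List α) :
    ∃ z : List α, z.length = lcsLen x y ∧ z.Sublist x ∧ z.Sublist y :=
  Nat.sSup_mem (s := {k | ∃ z : List α, z.length = k ∧ z.Sublist x ∧ z.Sublist y})
    ⟨0, [], by simp⟩ ⟨x.length, by rintro k ⟨z, rfl, hx, -⟩; exact hx.length_le⟩

theorem length_le_lcsLen {α : Type*} {x y z : List α} (hx : z.Sublist x) (hy : z.Sublist y) :
    z.length ≤ lcsLen x y :=
  le_csSup ⟨x.length, by rintro k ⟨z, rfl, hx, -⟩; exact hx.length_le⟩ ⟨z, rfl, hx, hy⟩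

theorem mdist_le_one_iff {n : ℕ} (hn : 0 < n) {α : Type*} (x y : Fin n → α) :
    mdist x y ≤ 1 ↔
      ∃ i < n, ∃ j < n, (List.ofFn x).eraseIdx i = (List.ofFn y).eraseIdx j := by
  constructor
  · intro h
    obtain ⟨z, hz, hx, hy⟩ := exists_sublist_length_eq_lcsLen (List.ofFn x) (List.ofFn y)
    have hlen : n - 1 ≤ z.length := by unfold mdist at h; omega
    have ht : (z.take (n - 1)).length = n - 1 := by simp [hlen]
    have hs := List.take_sublist (n - 1) z
    obtain ⟨i, hi, hi'⟩ := (hs.trans hx).exists_eq_eraseIdx (by simp only [List.length_ofFn]; omega)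
    obtain ⟨j, hj, hj'⟩ := (hs.trans hy).exists_eq_eraseIdx (by simp only [List.length_ofFn]; omega)
    exact ⟨i, by simpa using hi, j, by simpa using hj, hi'.symm.trans hj'⟩
  · rintro ⟨i, hi, j, hj, h⟩
    have := length_le_lcsLen (List.eraseIdx_sublist (List.ofFn x) i)
      (h ▸ List.eraseIdx_sublist (List.ofFn y) j)
    rw [List.length_eraseIdx_of_lt (by simpa using hi), List.length_ofFn] at this
    unfold mdist
    omega

/-- The position in a word of the letter that lands in position `p` when the letter in position
`i` is moved to position `j`. -/
def translocate (i j p : ℕ) : ℕ :=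
  if p < j then (if p < i then p else p + 1)
  else if p = j then i
  else if p ≤ i then p - 1 else p

theorem translocate_lt {n i j p : ℕ} (hi : i < n) (hj : j < n) (hp : p < n) :
    translocate i j p < n := by
  unfold translocate; split_ifs <;> omega

theorem translocate_injective (i j : ℕ) : Function.Injective (translocate i j) := by
  intro p q h
  unfold translocate at h; split_ifs at h <;> omega

/-- The word `0^r 1^r 2^r ⋯` (shifted to letters `1, 2, …`), with the letter in position `i` moved
to position `j`. -/
def blockMove (n r i j : ℕ) : Fin n → ℕ := fun p => translocate i j p / r + 1

theorem blockMove_eq_mreg {n i j : ℕ} (r : ℕ) (hi : i < n) (hj : j < n) :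
    ∃ π : Equiv.Perm (Fin n), blockMove n r i j = mreg r π := by
  let f : Fin n → Fin n := fun p => ⟨translocate i j p, translocate_lt hi hj p.2⟩
  have hf : Function.Injective f := fun p q h =>
    Fin.ext (translocate_injective i j (congrArg Fin.val h))
  exact ⟨Equiv.ofBijective f (Finite.injective_iff_bijective.1 hf), rfl⟩

theorem eraseIdx_ofFn_mreg_one_eq_iff {n r i j : ℕ} (hi : i < n) (hj : j < n)
    (π : Equiv.Perm (Fin n)) :
    (List.ofFn (mreg r (1 : Equiv.Perm (Fin n)))).eraseIdx i = (List.ofFn (mreg r π)).eraseIdx j ↔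
      mreg r π = blockMove n r i j := by
  constructor
  · intro h
    have hperm : (List.ofFn (mreg r π)).Perm (List.ofFn (mreg r (1 : Equiv.Perm (Fin n)))) :=
      Equiv.Perm.ofFn_comp_perm π (mreg r (1 : Equiv.Perm (Fin n)))
    have hj0 : (List.ofFn (mreg r π))[j]'(by simpa using hj) =
        (List.ofFn (mreg r (1 : Equiv.Perm (Fin n))))[i]'(by simpa using hi) := by
      have h1 := ((List.getElem_cons_eraseIdx_perm (l := List.ofFn (mreg r π)) (n := j)
        (by simpa using hj)).trans hperm).trans (List.getElem_cons_eraseIdx_perm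
          (l := List.ofFn (mreg r (1 : Equiv.Perm (Fin n)))) (n := i) (by simpa using hi)).symm
      rw [h, ← Multiset.coe_eq_coe, ← Multiset.cons_coe, ← Multiset.cons_coe,
        Multiset.cons_inj_left] at h1
      exact h1
    have key : ∀ q (hq : q + 1 < n),
        mreg r (1 : Equiv.Perm (Fin n)) ⟨if q < i then q else q + 1, by split_ifs <;> omega⟩ =
        mreg r π ⟨if q < j then q else q + 1, by split_ifs <;> omega⟩ := by
      intro q hq
      have h2 := congrArg (fun l => l[q]?) h
      simp only [List.getElem?_eraseIdx] at h2
      by_cases hqi : q < i <;> by_cases hqj : q < j <;>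
        simpa [hqi, hqj, hq, (by omega : q < n)] using h2
    funext ⟨p, hp⟩
    rcases lt_trichotomy p j with h3 | h3 | h3
    · have := key p (by omega)
      simp only [h3, if_true] at this
      rw [← this]
      simp [mreg, blockMove, translocate, h3]
    · subst h3
      simpa [mreg, blockMove, translocate] using hj0
    · obtain ⟨q, rfl⟩ : ∃ q, p = q + 1 := ⟨p - 1, by omega⟩
      have := key q hp
      simp only [show ¬ q < j by omega, if_false] at this
      rw [← this]
      simp [mreg, blockMove, translocate, show ¬ q + 1 < j by omega, show ¬ q + 1 = j by omega]
  · intro h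
    rw [h]
    refine List.ext_getElem (by simp [List.length_eraseIdx, hi, hj]) fun q h1 h2 => ?_
    simp only [List.getElem_eraseIdx, List.getElem_ofFn, mreg, blockMove, translocate]
    simp [List.length_eraseIdx, hi] at h1
    split_ifs <;> simp <;> omega

theorem msphere_one_one_eq {n r : ℕ} (hn : 0 < n) :
    msphere r (1 : Equiv.Perm (Fin n)) 1 = {m | ∃ i < n, ∃ j < n, m = blockMove n r i j} := by
  ext m
  constructor
  · rintro ⟨π, rfl, h⟩
    obtain ⟨i, hi, j, hj, h⟩ := (mdist_le_one_iff hn _ _).1 h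
    exact ⟨i, hi, j, hj, (eraseIdx_ofFn_mreg_one_eq_iff hi hj π).1 h⟩
  · rintro ⟨i, hi, j, hj, rfl⟩
    obtain ⟨π, hπ⟩ := blockMove_eq_mreg r hi hj
    exact ⟨π, hπ, (mdist_le_one_iff hn _ _).2
      ⟨i, hi, j, hj, (eraseIdx_ofFn_mreg_one_eq_iff hi hj π).2 hπ.symm⟩⟩

/-- Canonical representatives of the nontrivial moves across the boundary `c` between two blocks:
either the first letter after `c` moves left to `t`, or the last letter before `c` moves right
to `t + 1`, skipping the adjacent transposition at `c`. -/
def canonicalMove (n r : ℕ) (x : ℕ × ℕ) : Fin n → ℕ :=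
  if x.2 < (x.1 + 1) * r then blockMove n r ((x.1 + 1) * r) x.2
  else blockMove n r ((x.1 + 1) * r - 1) (x.2 + 1)

theorem blockMove_self (n r i : ℕ) : blockMove n r i i = fun p : Fin n => (p : ℕ) / r + 1 := by
  funext p
  unfold blockMove translocate
  congr 2
  split_ifs <;> omega

theorem div_eq_div_of_mem_block {r b p q : ℕ} (hp : b * r ≤ p) (hp' : p < b * r + r)
    (hq : b * r ≤ q) (hq' : q < b * r + r) : p / r = q / r := by
  rw [Nat.div_eq_of_lt_le hp (by rwa [Nat.succ_mul]),
    Nat.div_eq_of_lt_le hq (by rwa [Nat.succ_mul])]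

theorem blockMove_eq_of_div_eq {n r i j : ℕ} (hr : 0 < r) (h : i / r = j / r) :
    blockMove n r i j = blockMove n r 0 0 := by
  rw [blockMove_self]
  funext p
  have hi := Nat.div_mul_le_self i r
  have hi' := Nat.lt_div_mul_add hr (a := i)
  have hj := Nat.div_mul_le_self j r
  have hj' := Nat.lt_div_mul_add hr (a := j)
  rw [← h] at hj hj'
  simp only [blockMove, translocate]
  congr 1
  split_ifs <;> first
    | rfl
    | exact div_eq_div_of_mem_block (b := i / r) (by omega) (by omega) (by omega) (by omega)

theorem blockMove_left_eq {n r a i j : ℕ} (hi : a * r ≤ i) (hi' : i < a * r + r)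
    (hj : j < a * r) : blockMove n r i j = blockMove n r (a * r) j := by
  funext p
  simp only [blockMove, translocate]
  congr 1
  split_ifs <;> first
    | rfl
    | omega
    | exact div_eq_div_of_mem_block (b := a) (by omega) (by omega) (by omega) (by omega)

theorem blockMove_right_eq {n r a i j : ℕ} (hi : a * r ≤ i) (hi' : i < a * r + r)
    (hj : a * r + r ≤ j) : blockMove n r i j = blockMove n r (a * r + r - 1) j := by
  funext p
  simp only [blockMove, translocate]
  congr 1
  split_ifs <;> first
    | rfl
    | omega
    | exact div_eq_div_of_mem_block (b := a) (by omega) (by omega) (by omega) (by omega)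

theorem blockMove_adjacent (n r c : ℕ) (hc : 0 < c) :
    blockMove n r (c - 1) c = blockMove n r c (c - 1) := by
  funext p
  simp only [blockMove, translocate]
  congr 2
  split_ifs <;> omega

theorem exists_canonicalMove_eq {k r i j : ℕ} (hr : 0 < r) (hi : i < k * r) (hj : j < k * r)
    (h : i / r ≠ j / r) :
    ∃ x ∈ Finset.range (k - 1) ×ˢ Finset.range (k * r - 1),
      canonicalMove (k * r) r x = blockMove (k * r) r i j := by
  have hi1 := Nat.div_mul_le_self i r
  have hi2 := Nat.lt_div_mul_add hr (a := i)
  have hik : i / r < k := (Nat.div_lt_iff_lt_mul hr).2 hi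
  have hjk : j / r < k := (Nat.div_lt_iff_lt_mul hr).2 hj
  simp only [Finset.mem_product, Finset.mem_range, Prod.exists, canonicalMove]
  generalize i / r = a at *
  rcases h.lt_or_gt with h | h
  · have hc : (a + 1) * r ≤ j := (Nat.le_div_iff_mul_le hr).1 h
    rw [blockMove_right_eq hi1 hi2 (by rwa [← Nat.succ_mul])]
    rw [← Nat.succ_mul, Nat.succ_eq_add_one]
    have hc0 : 0 < (a + 1) * r := by positivity
    generalize hca : (a + 1) * r = c at *
    rcases hc.eq_or_lt with rfl | hc
    · exact ⟨a, c - 1, ⟨by omega, by omega⟩, by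
        simp only [hca]
        rw [if_pos (by omega), blockMove_adjacent _ _ _ hc0]⟩
    · exact ⟨a, j - 1, ⟨by omega, by omega⟩, by
        simp only [hca]
        rw [if_neg (by omega), Nat.sub_add_cancel (by omega)]⟩
  · have hc : j < a * r := (Nat.div_lt_iff_lt_mul hr).1 h
    rw [blockMove_left_eq hi1 hi2 hc]
    obtain ⟨b, rfl⟩ : ∃ b, a = b + 1 := Nat.exists_eq_add_one.2 (Nat.zero_lt_of_lt h)
    exact ⟨b, j, ⟨by omega, by omega⟩, if_pos hc⟩

theorem canonicalMove_apply {r : ℕ} (hr : 0 < r) (n a t : ℕ) (p : Fin n) :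
    canonicalMove n r (a, t) p =
      if t < (a + 1) * r then
        if (p : ℕ) = t then a + 2
        else if t < p ∧ (p : ℕ) ≤ (a + 1) * r then ((p : ℕ) - 1) / r + 1 else (p : ℕ) / r + 1
      else
        if (p : ℕ) = t + 1 then a + 1
        else if (a + 1) * r - 1 ≤ p ∧ (p : ℕ) ≤ t then ((p : ℕ) + 1) / r + 1
        else (p : ℕ) / r + 1 := by
  have h1 : (a + 1) * r / r = a + 1 := Nat.mul_div_cancel _ hr
  have h2 : ((a + 1) * r - 1) / r = a :=
    Nat.div_eq_of_lt_le (by rw [Nat.succ_mul]; omega) (by rw [Nat.succ_mul]; omega)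
  have hc0 : 0 < (a + 1) * r := by positivity
  simp only [canonicalMove]
  generalize (a + 1) * r = c at *
  split_ifs <;> simp only [blockMove, translocate] <;> split_ifs <;> omega

theorem canonicalMove_ne {n r : ℕ} (hr : 0 < r) {x : ℕ × ℕ} (hx : x.2 < n - 1) :
    canonicalMove n r x ≠ blockMove n r 0 0 := by
  obtain ⟨a, t⟩ := x
  dsimp only at hx
  intro h
  rw [blockMove_self] at h
  rcases lt_or_ge t ((a + 1) * r) with ht | ht
  · have h3 := congrFun h ⟨t, by omega⟩
    rw [canonicalMove_apply hr] at h3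
    have := (Nat.div_lt_iff_lt_mul hr).2 ht
    simp [ht] at h3
    omega
  · have h3 := congrFun h ⟨t + 1, by omega⟩
    rw [canonicalMove_apply hr] at h3
    have := (Nat.le_div_iff_mul_le hr).2 (ht.trans (Nat.le_add_right t 1))
    simp [ht.not_gt] at h3
    omega

theorem succ_mul_lt {k r a : ℕ} (hr : 0 < r) (ha : a < k - 1) : (a + 1) * r < k * r :=
  Nat.mul_lt_mul_of_pos_right (by omega) hr

theorem canonicalMove_injOn {n r : ℕ} (hr : 0 < r) :
    Set.InjOn (canonicalMove n r) {x | (x.1 + 1) * r < n ∧ x.2 < n - 1} := by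
  have hlt : ∀ {a p : ℕ}, p < (a + 1) * r → p / r < a + 1 := fun h => (Nat.div_lt_iff_lt_mul hr).2 h
  have hge : ∀ {a p : ℕ}, (a + 1) * r ≤ p → a + 1 ≤ p / r := fun h => (Nat.le_div_iff_mul_le hr).2 h
  have left_left : ∀ {a t b s : ℕ}, t < n → t < (a + 1) * r → s < (b + 1) * r → t < s →
      canonicalMove n r (a, t) ≠ canonicalMove n r (b, s) := by
    intro a t b s hn ht hs hts h
    have h1 := congrFun h ⟨t, hn⟩
    have := hlt ht
    simp [canonicalMove_apply hr, ht, hs, hts.ne, hts.not_gt] at h1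
    omega
  have right_right : ∀ {a t b s : ℕ}, s + 1 < n → (a + 1) * r ≤ t → (b + 1) * r ≤ s → t < s →
      canonicalMove n r (a, t) ≠ canonicalMove n r (b, s) := by
    intro a t b s hn ht hs hts h
    have h1 := congrFun h ⟨s + 1, hn⟩
    have : b + 1 ≤ (s + 1) / r := hge (hs.trans s.le_succ)
    simp [canonicalMove_apply hr, ht.not_gt, hs.not_gt, hts.ne', show ¬ s + 1 ≤ t by omega] at h1
    omega
  have left_right : ∀ {a t b s : ℕ}, s + 1 < n → t < (a + 1) * r → (b + 1) * r ≤ s →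
      canonicalMove n r (a, t) ≠ canonicalMove n r (b, s) := by
    intro a t b s hn ht hs h
    have hd : 0 < (b + 1) * r := by positivity
    have hta := hlt ht
    rcases lt_trichotomy t ((b + 1) * r - 1) with htd | htd | htd
    · have h1 := congrFun h ⟨t, by omega⟩
      simp [canonicalMove_apply hr, ht, hs.not_gt, show t ≠ s + 1 by omega,
        show ¬ (b + 1) * r ≤ t + 1 by omega] at h1
      omega
    · have h1 := congrFun h ⟨t, by omega⟩
      have h2 := congrFun h ⟨s + 1, hn⟩
      have htb : (t + 1) / r = b + 1 := by
        rw [htd, Nat.sub_add_cancel hd, Nat.mul_div_cancel _ hr]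
      simp [canonicalMove_apply hr, ht, hs.not_gt, show t ≠ s + 1 by omega,
        show (b + 1) * r ≤ t + 1 by omega, show t ≤ s by omega, htb] at h1
      subst h1
      have : a + 1 ≤ (s + 1) / r := hge (hs.trans s.le_succ)
      simp [canonicalMove_apply hr, ht, hs.not_gt, show s + 1 ≠ t by omega,
        show ¬ s + 1 ≤ (a + 1) * r by omega] at h2
      omega
    · have h1 := congrFun h ⟨(b + 1) * r - 1, by omega⟩
      have := hlt (show (b + 1) * r - 1 < (b + 1) * r by omega)
      have hdb : (b + 1) * r / r = b + 1 := Nat.mul_div_cancel _ hr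
      simp [canonicalMove_apply hr, ht, hs.not_gt, htd.ne, htd.not_gt,
        show (b + 1) * r - 1 ≠ s + 1 by omega, show (b + 1) * r ≤ s + 1 by omega,
        Nat.sub_add_cancel hd, hdb] at h1
      omega
  rintro ⟨a, t⟩ ⟨-, ht⟩ ⟨b, s⟩ ⟨-, hs⟩ h
  dsimp only at ht hs
  rcases lt_or_ge t ((a + 1) * r) with hta | hta <;>
    rcases lt_or_ge s ((b + 1) * r) with hsb | hsb
  · rcases lt_trichotomy t s with hts | rfl | hts
    · exact absurd h (left_left (by omega) hta hsb hts)
    · have h1 := congrFun h ⟨t, by omega⟩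
      simp [canonicalMove_apply hr, hta, hsb] at h1
      rw [h1]
    · exact absurd h.symm (left_left (by omega) hsb hta hts)
  · exact absurd h (left_right (by omega) hta hsb)
  · exact absurd h.symm (left_right (by omega) hsb hta)
  · rcases lt_trichotomy t s with hts | rfl | hts
    · exact absurd h (right_right (by omega) hta hsb hts)
    · have h1 := congrFun h ⟨t + 1, by omega⟩
      simp [canonicalMove_apply hr, hta.not_gt, hsb.not_gt] at h1
      rw [h1]
    · exact absurd h.symm (right_right (by omega) hsb hta hts)

/-- `|S(m_e^r, 1)| = 1 + (n-1)(n/r - 1)`. -/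
theorem msphere_identity_radius_one_card (n r : ℕ) (hn : 0 < n) (hr : 0 < r) (hdvd : r ∣ n) :
    (msphere r (1 : Equiv.Perm (Fin n)) 1).ncard = 1 + (n - 1) * (n / r - 1) := by
  obtain ⟨k, rfl⟩ : ∃ k, n = k * r := ⟨n / r, (Nat.div_mul_cancel hdvd).symm⟩
  rw [Nat.mul_div_cancel _ hr]
  have hset : msphere r (1 : Equiv.Perm (Fin (k * r))) 1 =
      ↑(insert (blockMove (k * r) r 0 0)
        ((Finset.range (k - 1) ×ˢ Finset.range (k * r - 1)).image (canonicalMove (k * r) r))) := by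
    rw [msphere_one_one_eq hn]
    ext m
    simp only [Set.mem_ofPred_eq, Finset.coe_insert, Set.mem_insert_iff, Finset.mem_coe,
      Finset.mem_image]
    constructor
    · rintro ⟨i, hi, j, hj, rfl⟩
      by_cases h : i / r = j / r
      · exact .inl (blockMove_eq_of_div_eq hr h)
      · exact .inr (exists_canonicalMove_eq hr hi hj h)
    · rintro (rfl | ⟨⟨a, t⟩, hx, rfl⟩)
      · exact ⟨0, hn, 0, hn, rfl⟩
      · simp only [Finset.mem_product, Finset.mem_range] at hx
        have hc := succ_mul_lt hr hx.1
        unfold canonicalMove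
        split_ifs
        · exact ⟨_, hc, t, by omega, rfl⟩
        · exact ⟨_, by omega, t + 1, by omega, rfl⟩
  rw [hset, Set.ncard_coe_finset, Finset.card_insert_of_notMem, Finset.card_image_of_injOn,
    Finset.card_product, Finset.card_range, Finset.card_range, add_comm, mul_comm (k - 1)]
  · refine (canonicalMove_injOn hr).mono fun x hx => ?_
    simp only [Finset.coe_product, Finset.coe_range, Set.mem_prod, Set.mem_Iio] at hx
    exact ⟨succ_mul_lt hr hx.1, hx.2⟩
  · simp only [Finset.mem_image, Finset.mem_product, Finset.mem_range, not_exists, not_and]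
    exact fun x hx => canonicalMove_ne hr hx.2
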